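/- Let {(~μ_t, μ_t) : t ≥ 0} be a two-state free convolution semigroup, and write ~μ = ~μ_1, μ = μ_1, so that φ_{~μ_t,μ_t} = t·φ_{~μ,μ} and φ_{μ_t} = t·φ_μ. Then on a suitable domain in ℂ⁺ the following evolution equations hold: ∂_t F_{~μ_t}(z) = φ_μ(F_{μ_t}(z)) − φ_{~μ,μ}(F_{μ_t}(z)) − φ_μ(F_{μ_t}(z))·∂_z F_{~μ_t}(z), and ∂_t F_{μ_t}(z) = − φ_μ(F_{μ_t}(z))·∂_z F_{μ_t}(z). -/

import Mathlib

open MeasureTheory Complex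

noncomputable section

/-- The Cauchy transform `G_μ(z) = ∫ 1/(z - x) dμ(x)` of a measure on `ℝ`. -/
def cauchyG (μ : Measure ℝ) (z : ℂ) : ℂ := ∫ x : ℝ, (z - (x : ℂ))⁻¹ ∂μ

/-- The F-transform `F_μ = 1/G_μ`. -/
def Ftr (μ : Measure ℝ) (z : ℂ) : ℂ := (cauchyG μ z)⁻¹

/-- The open upper half-plane `ℂ⁺`. -/
def UHP : Set ℂ := {z : ℂ | 0 < z.im}

/-- The truncated cone `Γ_{α,M} = {z ∈ ℂ⁺ : |Re z| < α · Im z, Im z > M}`. -/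
def tcone (α M : ℝ) : Set ℂ := {z : ℂ | |z.re| < α * z.im ∧ M < z.im}

/-- `φ` is a Voiculescu transform of `μ`: `φ(F_μ(z)) + F_μ(z) = z` on some truncated cone. -/
def IsVT (μ : Measure ℝ) (φ : ℂ → ℂ) : Prop :=
  ∃ α M : ℝ, 0 < α ∧ 0 < M ∧ ∀ z ∈ tcone α M, φ (Ftr μ z) + Ftr μ z = z

/-- `ψ` is a two-state Voiculescu transform of the pair `(μt, μ)`:
`ψ(F_μ(z)) + F_{μt}(z) = z` on some truncated cone. -/
def IsTwoStateVT (μt μ : Measure ℝ) (ψ : ℂ → ℂ) : Prop :=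
  ∃ α M : ℝ, 0 < α ∧ 0 < M ∧ ∀ z ∈ tcone α M, ψ (Ftr μ z) + Ftr μt z = z

/-- `μ` is freely infinitely divisible: some Voiculescu transform `φ` of `μ` is such that
`t·φ` is a Voiculescu transform of a probability measure for every `t ≥ 0`. -/
def IsFID (μ : Measure ℝ) : Prop :=
  ∃ φ : ℂ → ℂ, IsVT μ φ ∧ ∀ t : ℝ, 0 ≤ t →
    ∃ ν : Measure ℝ, IsProbabilityMeasure ν ∧ IsVT ν (fun z => (t : ℂ) * φ z)

/-- The semicircular distribution with mean `β` and variance `γ` (Dirac mass at `β` for `γ = 0`). -/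
def semicircle (β γ : ℝ) : Measure ℝ :=
  if γ = 0 then Measure.dirac β
  else volume.withDensity
    (fun x => ENNReal.ofReal ((2 * Real.pi * γ)⁻¹ * Real.sqrt (4 * γ - (x - β) ^ 2)))

lemma tcone_mono {α α' M M' : ℝ} (hα : α ≤ α') (hM : 0 ≤ M) (hM' : M' ≤ M) :
    tcone α M ⊆ tcone α' M' := fun _ hz =>
  ⟨hz.1.trans_le (mul_le_mul_of_nonneg_right hα (hM.trans hz.2.le)), hM'.trans_lt hz.2⟩

lemma tcone_subset_UHP {α M : ℝ} (hM : 0 ≤ M) : tcone α M ⊆ UHP := fun _ hz =>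
  hM.trans_lt hz.2

lemma isOpen_UHP : IsOpen UHP := isOpen_lt continuous_const continuous_im

lemma isOpen_tcone (α M : ℝ) : IsOpen (tcone α M) :=
  (isOpen_lt (f := fun z : ℂ => |z.re|) (g := fun z : ℂ => α * z.im) (by fun_prop)
    (by fun_prop)).inter (isOpen_lt continuous_const continuous_im)

lemma convex_tcone (α M : ℝ) : Convex ℝ (tcone α M) := by
  intro z hz w hw a b ha hb hab
  have h1 := abs_lt.1 hz.1
  have h2 := abs_lt.1 hw.1
  have hz2 := hz.2
  have hw2 := hw.2
  simp only [tcone, Set.mem_ofPred_eq, abs_lt, add_re, add_im, real_smul, mul_re, mul_im,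
    ofReal_re, ofReal_im, zero_mul, sub_zero, add_zero]
  obtain rfl : b = 1 - a := by linarith
  rcases ha.eq_or_lt with rfl | ha
  · simp only [zero_mul, sub_zero, one_mul, zero_add]
    exact ⟨⟨by linarith, by linarith⟩, by linarith⟩
  · refine ⟨⟨?_, ?_⟩, ?_⟩ <;> nlinarith

lemma mul_I_mem_tcone {α M y : ℝ} (hα : 0 < α) (hM : 0 ≤ M) (hy : M < y) :
    (y : ℂ) * I ∈ tcone α M := by
  have : 0 < y := hM.trans_lt hy
  simpa [tcone, hy] using mul_pos hα this

lemma norm_le_of_mem_tcone {α M : ℝ} {z : ℂ} (hM : 0 ≤ M) (hz : z ∈ tcone α M) :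
    ‖z‖ ≤ (α + 1) * z.im := by
  have h := Complex.norm_le_abs_re_add_abs_im z
  rw [abs_of_pos (hM.trans_lt hz.2)] at h
  linarith [hz.1]

/-- A ball around a point of a cone, of radius a small multiple of the norm of the point, is
contained in any wider cone. -/
lemma exists_ball_subset_tcone {α' α : ℝ} (hα' : 0 < α') (hα : α' < α) :
    ∃ r : ℝ, 0 < r ∧ r < 1 ∧ ∀ M, 0 ≤ M → ∀ z ∈ tcone α' M, ∀ w : ℂ, ‖w - z‖ ≤ r * ‖z‖ →
      w ∈ tcone α (z.im / 2) := by
  have hα0 : 0 < α := hα'.trans hα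
  have h1 : 0 < 2 * ((α' + 1) * (α + 1)) := by positivity
  refine ⟨(α - α') / (2 * ((α' + 1) * (α + 1))), div_pos (by linarith) h1, ?_, ?_⟩
  · rw [div_lt_one h1]; nlinarith
  intro M hM z hz w hw
  have hy : 0 < z.im := hM.trans_lt hz.2
  have hd : ‖w - z‖ ≤ (α - α') / (2 * (α + 1)) * z.im := by
    refine hw.trans ((mul_le_mul_of_nonneg_left (norm_le_of_mem_tcone hM hz)
      (div_nonneg (by linarith) h1.le)).trans_eq ?_)
    field_simp
  set e := (α - α') / (2 * (α + 1)) with he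
  have he' : e * (2 * (α + 1)) = α - α' := by
    have : α + 1 ≠ 0 := by positivity
    rw [he]; field_simp
  have h2 : e < 1 / 2 := by nlinarith
  have hre := (Complex.abs_re_le_norm (w - z)).trans hd
  have him := (Complex.abs_im_le_norm (w - z)).trans hd
  rw [sub_re, abs_le] at hre
  rw [sub_im, abs_le] at him
  have hz1 := abs_lt.1 hz.1
  have key : α' * z.im + e * z.im ≤ α * (z.im - e * z.im) := by
    have : α' + e ≤ α * (1 - e) := by nlinarith
    nlinarith
  have key2 : α * (z.im - e * z.im) ≤ α * w.im :=
    mul_le_mul_of_nonneg_left (by linarith) (by linarith)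
  refine ⟨abs_lt.2 ⟨?_, ?_⟩, ?_⟩
  · linarith
  · linarith
  · nlinarith

lemma sub_ofReal_ne_zero {z : ℂ} (hz : 0 < z.im) (x : ℝ) : z - x ≠ 0 := fun h => by
  have := congrArg im h
  simp at this
  exact hz.ne' this

lemma im_le_norm_sub_ofReal (z : ℂ) (x : ℝ) : z.im ≤ ‖z - x‖ := by
  simpa using (le_abs_self _).trans (Complex.abs_im_le_norm (z - x))

lemma norm_inv_sub_ofReal_le {z : ℂ} (hz : 0 < z.im) (x : ℝ) : ‖(z - x)⁻¹‖ ≤ z.im⁻¹ := by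
  rw [norm_inv]
  exact inv_anti₀ hz (im_le_norm_sub_ofReal z x)

lemma measurable_inv_sub_ofReal (z : ℂ) : Measurable fun x : ℝ => (z - (x : ℂ))⁻¹ := by
  fun_prop

lemma integrable_inv_sub_ofReal (ν : Measure ℝ) [IsProbabilityMeasure ν] {z : ℂ}
    (hz : 0 < z.im) : Integrable (fun x : ℝ => (z - (x : ℂ))⁻¹) ν :=
  .of_bound (measurable_inv_sub_ofReal z).aestronglyMeasurable z.im⁻¹
    (.of_forall (norm_inv_sub_ofReal_le hz))

lemma cauchyG_ne_zero (ν : Measure ℝ) [IsProbabilityMeasure ν] {z : ℂ} (hz : 0 < z.im) :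
    cauchyG ν z ≠ 0 := by
  intro h
  have hint := (integrable_inv_sub_ofReal ν hz)
  have him : ∫ x : ℝ, -((z - (x : ℂ))⁻¹).im ∂ν = 0 := by
    have := integral_im hint
    rw [integral_neg]
    simp only [RCLike.im_to_complex] at this
    rw [this]
    simpa [cauchyG] using congrArg im h
  have hpos : ∀ x : ℝ, 0 < -((z - (x : ℂ))⁻¹).im := fun x => by
    have := normSq_pos.2 (sub_ofReal_ne_zero hz x)
    simp only [inv_im, sub_im, ofReal_im, sub_zero, neg_div, neg_neg]
    positivity
  have hint' : Integrable (fun x : ℝ => -((z - (x : ℂ))⁻¹).im) ν := hint.im.neg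
  rw [integral_eq_zero_iff_of_nonneg (fun x => (hpos x).le) hint'] at him
  obtain ⟨x, hx⟩ := him.exists
  exact (hpos x).ne' hx

lemma differentiableOn_cauchyG (ν : Measure ℝ) [IsProbabilityMeasure ν] :
    DifferentiableOn ℂ (cauchyG ν) UHP := by
  intro z hz
  have hz : 0 < z.im := hz
  have hU : {w : ℂ | z.im / 2 < w.im} ∈ nhds z :=
    (isOpen_lt continuous_const continuous_im).mem_nhds (by simpa using hz)
  refine (hasDerivAt_integral_of_dominated_loc_of_deriv_le (μ := ν)
    (F := fun (w : ℂ) (x : ℝ) => (w - (x : ℂ))⁻¹) (F' := fun w x => -1 / (w - (x : ℂ)) ^ 2)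
    (bound := fun _ => (z.im / 2)⁻¹ ^ 2) hU
    (.of_forall fun w => (measurable_inv_sub_ofReal w).aestronglyMeasurable)
    (integrable_inv_sub_ofReal ν hz) ?_ (.of_forall fun x w hw => ?_)
    (integrable_const _)
    (.of_forall fun x w hw => ?_)).2.differentiableAt.differentiableWithinAt
  · exact Measurable.aestronglyMeasurable (by fun_prop)
  · have hw : z.im / 2 < w.im := hw
    have h := norm_inv_sub_ofReal_le (by linarith : 0 < w.im) x
    rw [neg_div, norm_neg, one_div, ← inv_pow, norm_pow]
    exact pow_le_pow_left₀ (norm_nonneg _) (h.trans (inv_anti₀ (by linarith) hw.le)) 2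
  · have hw : z.im / 2 < w.im := hw
    exact ((hasDerivAt_id' w).sub_const (x : ℂ)).fun_inv (sub_ofReal_ne_zero (by linarith) x)

lemma differentiableOn_Ftr (ν : Measure ℝ) [IsProbabilityMeasure ν] :
    DifferentiableOn ℂ (Ftr ν) UHP :=
  (differentiableOn_cauchyG ν).inv fun _ hz => cauchyG_ne_zero ν hz

/-- `F_ν(z) - z = o(z)` as `z → ∞` nontangentially. -/
lemma exists_norm_Ftr_sub_le (ν : Measure ℝ) [IsProbabilityMeasure ν] (α : ℝ) {ε : ℝ}
    (hε : 0 < ε) : ∃ M : ℝ, 0 < M ∧ ∀ z ∈ tcone α M, ‖Ftr ν z - z‖ ≤ ε * ‖z‖ := by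
  let L : Filter ℂ := Filter.comap im Filter.atTop ⊓ Filter.principal (tcone α 0)
  have hL0 : ∀ᶠ z in L, z ∈ tcone α 0 := Filter.mem_inf_of_right (Filter.mem_principal_self _)
  have him : Filter.Tendsto im L Filter.atTop := Filter.tendsto_comap.mono_left inf_le_left
  have hlim : Filter.Tendsto (fun z => ∫ x : ℝ, z * (z - (x : ℂ))⁻¹ ∂ν) L
      (nhds (∫ _ : ℝ, (1 : ℂ) ∂ν)) := by
    refine tendsto_integral_filter_of_dominated_convergence (fun _ => α + 1)
      (.of_forall fun z => Measurable.aestronglyMeasurable (by fun_prop)) ?_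
      (integrable_const _) (.of_forall fun x => ?_)
    · filter_upwards [hL0] with z hz
      refine .of_forall fun x => ?_
      have hy : 0 < z.im := hz.2
      rw [norm_mul]
      calc ‖z‖ * ‖(z - (x : ℂ))⁻¹‖ ≤ ((α + 1) * z.im) * z.im⁻¹ :=
            mul_le_mul (norm_le_of_mem_tcone le_rfl hz) (norm_inv_sub_ofReal_le hy x)
              (norm_nonneg _) ((norm_nonneg _).trans (norm_le_of_mem_tcone le_rfl hz))
        _ = α + 1 := by field_simp
    · have h0 : Filter.Tendsto (fun z : ℂ => (x : ℂ) * (z - (x : ℂ))⁻¹) L (nhds ((x : ℂ) * 0)) := by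
        refine Filter.Tendsto.const_mul _ (squeeze_zero_norm' ?_
          (tendsto_inv_atTop_zero.comp him))
        filter_upwards [hL0] with z hz using norm_inv_sub_ofReal_le hz.2 x
      have h1 := h0.const_add 1
      rw [mul_zero, add_zero] at h1
      refine h1.congr' ?_
      filter_upwards [hL0] with z hz
      have := sub_ofReal_ne_zero hz.2 x
      field_simp
      ring
  have hG : Filter.Tendsto (fun z => (z * cauchyG ν z)⁻¹) L (nhds 1) := by
    have h := hlim.inv₀ (by simp)
    simpa [cauchyG, integral_const_mul] using h
  have hev : ∀ᶠ z in L, ‖Ftr ν z - z‖ ≤ ε * ‖z‖ := by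
    filter_upwards [hL0, Metric.tendsto_nhds.1 hG ε hε] with z hz h
    have hz0 : z ≠ 0 := fun h0 => by simpa [h0] using hz.2
    have : Ftr ν z - z = ((z * cauchyG ν z)⁻¹ - 1) * z := by
      rw [Ftr, mul_inv]; field_simp
    rw [this, norm_mul]
    exact mul_le_mul_of_nonneg_right (by rw [← dist_eq_norm]; exact h.le) (norm_nonneg _)
  rw [Filter.eventually_inf_principal, Filter.eventually_comap] at hev
  obtain ⟨M, hM⟩ := Filter.eventually_atTop.1 hev
  refine ⟨max M 1, by positivity, fun z hz => hM z.im ((le_max_left _ _).trans hz.2.le) z rfl ?_⟩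
  exact tcone_mono le_rfl (by positivity) (by positivity) hz

/-- A perturbation `id + g` of the identity that is small on a cone is injective on a smaller cone,
and has a holomorphic right inverse on a still smaller cone. -/
lemma exists_rightInverse_on_tcone {α' α'' α : ℝ} (hα' : 0 < α') (h1 : α' < α'') (h2 : α'' < α) :
    ∃ ε : ℝ, 0 < ε ∧ ∀ M, 0 < M → ∀ g : ℂ → ℂ, DifferentiableOn ℂ g (tcone α M) →
      (∀ z ∈ tcone α M, ‖g z‖ ≤ ε * ‖z‖) →
      (∀ x ∈ tcone α'' (2 * M), ∀ y ∈ tcone α'' (2 * M), ‖g x - g y‖ ≤ 1 / 2 * ‖x - y‖) ∧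
      ∃ K : ℂ → ℂ, ∀ w ∈ tcone α' (4 * M), K w ∈ tcone α'' (w.im / 2) ∧ K w + g (K w) = w ∧
        DifferentiableAt ℂ K w ∧ ‖K w‖ ≤ 2 * ‖w‖ := by
  obtain ⟨r₁, hr₁, hr₁', hball₁⟩ := exists_ball_subset_tcone (hα'.trans h1) h2
  obtain ⟨r₂, hr₂, hr₂', hball₂⟩ := exists_ball_subset_tcone hα' h1
  refine ⟨r₁ * r₂ / 4, by positivity, fun M hM g hg hgb => ?_⟩
  have hmono : tcone α'' (2 * M) ⊆ tcone α M := tcone_mono h2.le (by linarith) (by linarith)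
  have hderiv : ∀ z ∈ tcone α'' (2 * M), ‖deriv g z‖ ≤ 1 / 2 := by
    intro z hz
    have hz0 : 0 < ‖z‖ := norm_pos_iff.2 fun h => by
      have := hz.2
      rw [h, zero_im] at this
      linarith
    have hR : 0 < r₁ * ‖z‖ := by positivity
    have hsub : Metric.closedBall z (r₁ * ‖z‖) ⊆ tcone α M := fun w hw => by
      rw [Metric.mem_closedBall, dist_eq_norm] at hw
      exact tcone_mono le_rfl (by linarith [hz.2]) (by linarith [hz.2])
        (hball₁ (2 * M) (by linarith) z hz w hw)
    refine (Complex.norm_deriv_le_of_forall_mem_sphere_norm_le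
      (C := r₁ * r₂ / 4 * (2 * ‖z‖)) hR ?_ fun w hw => ?_).trans ?_
    · exact ((hg.mono hsub).mono Metric.closure_ball_subset_closedBall).diffContOnCl
    · have hw' := Metric.sphere_subset_closedBall hw
      refine (hgb w (hsub hw')).trans (mul_le_mul_of_nonneg_left ?_ (by positivity))
      rw [Metric.mem_closedBall, dist_eq_norm] at hw'
      nlinarith [norm_le_norm_add_norm_sub' w z]
    · rw [div_le_iff₀ hR]
      nlinarith
  have hdiff : ∀ z ∈ tcone α'' (2 * M), DifferentiableAt ℂ g z := fun z hz =>
    hg.differentiableAt ((isOpen_tcone α M).mem_nhds (hmono hz))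
  have hlip : ∀ x ∈ tcone α'' (2 * M), ∀ y ∈ tcone α'' (2 * M),
      ‖g x - g y‖ ≤ 1 / 2 * ‖x - y‖ := fun x hx y hy =>
    (convex_tcone α'' (2 * M)).norm_image_sub_le_of_norm_deriv_le hdiff hderiv hy hx
  refine ⟨hlip, ?_⟩
  have hex : ∀ w ∈ tcone α' (4 * M), ∃ k, k ∈ tcone α'' (w.im / 2) ∧ k + g k = w ∧
      ‖k‖ ≤ 2 * ‖w‖ := by
    intro w hw
    have hsub : Metric.closedBall w (r₂ * ‖w‖) ⊆ tcone α'' (w.im / 2) := fun z hz => by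
      rw [Metric.mem_closedBall, dist_eq_norm] at hz
      exact hball₂ (4 * M) (by linarith) w hw z hz
    have hsub' : tcone α'' (w.im / 2) ⊆ tcone α'' (2 * M) :=
      tcone_mono le_rfl (by linarith [hw.2]) (by linarith [hw.2])
    have hnorm : ∀ z ∈ Metric.closedBall w (r₂ * ‖w‖), ‖z‖ ≤ 2 * ‖w‖ := fun z hz => by
      rw [Metric.mem_closedBall, dist_eq_norm] at hz
      nlinarith [norm_le_norm_add_norm_sub' z w, norm_nonneg w]
    have hmaps : Set.MapsTo (fun z => w - g z) (Metric.closedBall w (r₂ * ‖w‖))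
        (Metric.closedBall w (r₂ * ‖w‖)) := fun z hz => by
      rw [Metric.mem_closedBall, dist_eq_norm, sub_sub_cancel_left, norm_neg]
      refine (hgb z (hmono (hsub' (hsub hz)))).trans ?_
      calc r₁ * r₂ / 4 * ‖z‖ ≤ r₁ * r₂ / 4 * (2 * ‖w‖) :=
            mul_le_mul_of_nonneg_left (hnorm z hz) (by positivity)
        _ = (r₁ / 2) * (r₂ * ‖w‖) := by ring
        _ ≤ 1 * (r₂ * ‖w‖) := mul_le_mul_of_nonneg_right (by linarith) (by positivity)
        _ = r₂ * ‖w‖ := one_mul _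
    have hcontr : ContractingWith (1 / 2) (hmaps.restrict _ _ _) := by
      refine ⟨by rw [← NNReal.coe_lt_coe]; norm_num, LipschitzWith.of_dist_le_mul fun x y => ?_⟩
      rw [Subtype.dist_eq, Subtype.dist_eq, dist_eq_norm, dist_eq_norm]
      simp only [Set.MapsTo.val_restrict_apply, sub_sub_sub_cancel_left]
      rw [norm_sub_rev]
      simpa using hlip x (hsub' (hsub x.2)) y (hsub' (hsub y.2))
    obtain ⟨k, hk, hfix, -⟩ := ContractingWith.exists_fixedPoint'
      Metric.isClosed_closedBall.isComplete hmaps hcontr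
      (Metric.mem_closedBall_self (by positivity)) (edist_ne_top _ _)
    refine ⟨k, hsub hk, ?_, hnorm k hk⟩
    have : w - g k = k := hfix
    linear_combination -this
  choose! K hK₁ hK₂ hK₃ using hex
  refine ⟨K, fun w hw => ⟨hK₁ w hw, hK₂ w hw, ?_, hK₃ w hw⟩⟩
  have hKmem : ∀ v ∈ tcone α' (4 * M), K v ∈ tcone α'' (2 * M) := fun v hv =>
    tcone_mono le_rfl (by linarith [hv.2]) (by linarith [hv.2]) (hK₁ v hv)
  have hnhds := (isOpen_tcone α' (4 * M)).mem_nhds hw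
  have hcont : ContinuousAt K w := by
    rw [ContinuousAt, tendsto_iff_norm_sub_tendsto_zero]
    have hlim : Filter.Tendsto (fun v => 2 * ‖v - w‖) (nhds w) (nhds 0) := by
      have : Continuous fun v : ℂ => 2 * ‖v - w‖ := by fun_prop
      simpa using this.tendsto w
    refine squeeze_zero' (.of_forall fun _ => norm_nonneg _) ?_ hlim
    filter_upwards [hnhds] with v hv
    have h := hlip _ (hKmem v hv) _ (hKmem w hw)
    have h' : K v - K w = (v - w) - (g (K v) - g (K w)) := by
      linear_combination hK₂ v hv - hK₂ w hw
    have h'' := norm_sub_le (v - w) (g (K v) - g (K w))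
    rw [← h'] at h''
    linarith
  have hd : HasDerivAt (fun z => z + g z) (1 + deriv g (K w)) (K w) :=
    (hasDerivAt_id' _).add (hdiff _ (hKmem w hw)).hasDerivAt
  have hne : 1 + deriv g (K w) ≠ 0 := fun h => by
    have h' := hderiv _ (hKmem w hw)
    rw [eq_neg_of_add_eq_zero_right h, norm_neg, norm_one] at h'
    norm_num at h'
  exact (hd.of_local_left_inverse hcont hne
    (Filter.mem_of_superset hnhds fun v hv => hK₂ v hv)).differentiableAt

/-- On some cone the transforms `φ` and `ψ` are holomorphic, and `φ(w) = o(w)`. -/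
lemma exists_differentiableOn_VT {ν tν : Measure ℝ} [IsProbabilityMeasure ν]
    [IsProbabilityMeasure tν] {φ ψ : ℂ → ℂ} (hφ : IsVT ν φ) (hψ : IsTwoStateVT tν ν ψ) :
    ∃ β M : ℝ, 0 < β ∧ 0 < M ∧ DifferentiableOn ℂ φ (tcone β M) ∧
      DifferentiableOn ℂ ψ (tcone β M) ∧
      ∀ ε : ℝ, 0 < ε → ∃ M', M ≤ M' ∧ ∀ w ∈ tcone β M', ‖φ w‖ ≤ ε * ‖w‖ := by
  obtain ⟨α₁, N₁, hα₁, hN₁, hφ⟩ := hφ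
  obtain ⟨α₂, N₂, hα₂, hN₂, hψ⟩ := hψ
  obtain ⟨α, hα, hαα₁, hαα₂⟩ : ∃ α, 0 < α ∧ α ≤ α₁ ∧ α ≤ α₂ :=
    ⟨min α₁ α₂, lt_min hα₁ hα₂, min_le_left _ _, min_le_right _ _⟩
  obtain ⟨ε, hε, hinv⟩ := exists_rightInverse_on_tcone (α' := α / 4) (α'' := α / 2) (α := α)
    (by positivity) (by linarith) (by linarith)
  obtain ⟨M₀, hM₀, hF⟩ := exists_norm_Ftr_sub_le ν α hε
  obtain ⟨M, hM, hMM₀, hMN₁, hMN₂⟩ : ∃ M, 0 < M ∧ M₀ ≤ M ∧ N₁ ≤ M ∧ N₂ ≤ M :=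
    ⟨max M₀ (max N₁ N₂), lt_max_of_lt_left hM₀, by simp, by simp, by simp⟩
  obtain ⟨-, K, hK⟩ := hinv M hM (fun z => Ftr ν z - z)
    (((differentiableOn_Ftr ν).mono (tcone_subset_UHP hM.le)).sub differentiableOn_id)
    fun z hz => hF z (tcone_mono le_rfl hM.le hMM₀ hz)
  have hKmem : ∀ w ∈ tcone (α / 4) (4 * M), K w ∈ tcone α M := fun w hw =>
    tcone_mono (by linarith) (by linarith [hw.2]) (by linarith [hw.2]) (hK w hw).1
  have hFK : ∀ w ∈ tcone (α / 4) (4 * M), Ftr ν (K w) = w := fun w hw => by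
    linear_combination (hK w hw).2.1
  have hφK : ∀ w ∈ tcone (α / 4) (4 * M), φ w = K w - w := fun w hw => by
    have h := hφ _ (tcone_mono hαα₁ hM.le hMN₁ (hKmem w hw))
    rw [hFK w hw] at h
    linear_combination h
  have hψK : ∀ w ∈ tcone (α / 4) (4 * M), ψ w = K w - Ftr tν (K w) := fun w hw => by
    have h := hψ _ (tcone_mono hαα₂ hM.le hMN₂ (hKmem w hw))
    rw [hFK w hw] at h
    linear_combination h
  have hKd : DifferentiableOn ℂ K (tcone (α / 4) (4 * M)) := fun w hw =>
    (hK w hw).2.2.1.differentiableWithinAt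
  refine ⟨α / 4, 4 * M, by positivity, by positivity, (hKd.sub differentiableOn_id).congr hφK,
    (hKd.sub (((differentiableOn_Ftr tν).mono (tcone_subset_UHP hM.le)).comp hKd hKmem)).congr hψK,
    fun η hη => ?_⟩
  obtain ⟨M₁, hM₁, hF₁⟩ := exists_norm_Ftr_sub_le ν α (half_pos hη)
  refine ⟨max (4 * M) (2 * M₁), le_max_left _ _, fun w hw => ?_⟩
  have hw' : w ∈ tcone (α / 4) (4 * M) :=
    tcone_mono le_rfl (by positivity) (le_max_left _ _) hw
  have hw2 : 2 * M₁ < w.im := (le_max_right _ _).trans_lt hw.2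
  have h := hF₁ _ (tcone_mono (by linarith) (by linarith) (by linarith) (hK w hw').1)
  rw [hFK w hw', norm_sub_rev, ← hφK w hw'] at h
  nlinarith [(hK w hw').2.2.2]

/-- The functional equations of `F_ν` and `F_tν` for the transforms `s·φ` and `s·ψ` hold on a cone
that does not depend on `s ∈ (0, T)`. -/
lemma exists_uniform_tcone {φ ψ : ℂ → ℂ} {β M : ℝ} (hβ : 0 < β) (hM : 0 < M)
    (hφ : DifferentiableOn ℂ φ (tcone β M)) (hψ : DifferentiableOn ℂ ψ (tcone β M))
    (hφo : ∀ ε : ℝ, 0 < ε → ∃ M', M ≤ M' ∧ ∀ w ∈ tcone β M', ‖φ w‖ ≤ ε * ‖w‖)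
    {T : ℝ} (hT : 0 < T) :
    ∃ γ δ N C : ℝ, 0 < γ ∧ 0 < N ∧ 0 ≤ C ∧ tcone δ N ⊆ tcone β M ∧
      (∀ w ∈ tcone δ N, ‖φ w‖ ≤ C * ‖w‖) ∧ ∀ s : ℝ, 0 < s → s < T →
      (∀ x ∈ tcone δ N, ∀ y ∈ tcone δ N, ‖s * φ x - s * φ y‖ ≤ 1 / 2 * ‖x - y‖) ∧
      ∀ ν tν : Measure ℝ, IsProbabilityMeasure ν → IsProbabilityMeasure tν →
        IsVT ν (fun z => s * φ z) → IsTwoStateVT tν ν (fun z => s * ψ z) →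
        ∀ z ∈ tcone γ (2 * N), Ftr ν z ∈ tcone δ N ∧ ‖Ftr ν z‖ ≤ 2 * ‖z‖ ∧
          s * φ (Ftr ν z) + Ftr ν z = z ∧ s * ψ (Ftr ν z) + Ftr tν z = z := by
  obtain ⟨ε, hε, hinv⟩ := exists_rightInverse_on_tcone (α' := β / 4) (α'' := β / 2) (α := β)
    (by positivity) (by linarith) (by linarith)
  obtain ⟨r, hr, -, hball⟩ := exists_ball_subset_tcone (α' := β / 4) (α := β / 2)
    (by positivity) (by linarith)
  obtain ⟨M', hMM', hφb⟩ := hφo (ε / T) (by positivity)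
  have hM' : 0 < M' := hM.trans_le hMM'
  have hsub : tcone β M' ⊆ tcone β M := tcone_mono le_rfl hM'.le hMM'
  have hsub' : tcone (β / 2) (2 * M') ⊆ tcone β M' :=
    tcone_mono (by linarith) (by linarith) (by linarith)
  refine ⟨β / 4, β / 2, 2 * M', ε / T, by positivity, by positivity, by positivity,
    hsub'.trans hsub, fun w hw => hφb w (hsub' hw), fun s hs hsT => ?_⟩
  obtain ⟨hlip, K, hK⟩ := hinv M' hM' (fun z => s * φ z) ((hφ.mono hsub).const_mul _) fun z hz => by
    rw [norm_mul, norm_real, Real.norm_of_nonneg hs.le]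
    calc s * ‖φ z‖ ≤ T * (ε / T * ‖z‖) :=
          mul_le_mul hsT.le (hφb z hz) (norm_nonneg _) hT.le
      _ = ε * ‖z‖ := by field_simp
  refine ⟨hlip, fun ν tν _ _ hν htν => ?_⟩
  rw [← mul_assoc, show (2 : ℝ) * 2 = 4 by norm_num]
  obtain ⟨α₁, N₁, hα₁, hN₁, hν⟩ := hν
  obtain ⟨α₂, N₂, hα₂, hN₂, htν⟩ := htν
  obtain ⟨L, hL, hF⟩ := exists_norm_Ftr_sub_le ν (β / 4) hr
  obtain ⟨α, hα, hαβ, hαα₁, hαα₂⟩ : ∃ α, 0 < α ∧ α ≤ β / 4 ∧ α ≤ α₁ ∧ α ≤ α₂ :=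
    ⟨min (β / 4) (min α₁ α₂), by positivity, by simp, by simp, by simp⟩
  obtain ⟨R, hR, hRM, hRN₁, hRN₂, hRL⟩ : ∃ R, 0 < R ∧ 4 * M' ≤ R ∧ N₁ ≤ R ∧ N₂ ≤ R ∧ L ≤ R :=
    ⟨max (max (4 * M') L) (max N₁ N₂), by positivity, by simp, by simp, by simp, by simp⟩
  have hKmem : ∀ z ∈ tcone (β / 4) (4 * M'), K z ∈ tcone (β / 2) (2 * M') := fun z hz =>
    tcone_mono le_rfl (by linarith [hz.2]) (by linarith [hz.2]) (hK z hz).1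
  have hdeep : ∀ z ∈ tcone α R, Ftr ν z = K z := by
    intro z hz
    have hz' : z ∈ tcone (β / 4) (4 * M') := tcone_mono hαβ hR.le hRM hz
    have hmem : Ftr ν z ∈ tcone (β / 2) (2 * M') :=
      tcone_mono le_rfl (by linarith [hz'.2]) (by linarith [hz'.2])
        (hball _ (by positivity) z hz' _ (hF z (tcone_mono hαβ hR.le hRL hz)))
    have h := hlip _ hmem _ (hKmem z hz')
    have h1 := hν z (tcone_mono hαα₁ hR.le hRN₁ hz)
    have h2 := (hK z hz').2.1
    rw [show (s : ℂ) * φ (Ftr ν z) - s * φ (K z) = -(Ftr ν z - K z) by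
      linear_combination h1 - h2, norm_neg] at h
    exact sub_eq_zero.1 (norm_eq_zero.1 (by linarith [norm_nonneg (Ftr ν z - K z)]))
  have hopen := isOpen_tcone (β / 4) (4 * M')
  have hUHP : tcone (β / 4) (4 * M') ⊆ UHP := tcone_subset_UHP (by positivity)
  have hz₀ : ((R + 1 : ℝ) : ℂ) * I ∈ tcone α R := mul_I_mem_tcone hα hR.le (by linarith)
  have hz₀' := tcone_mono hαβ hR.le hRM hz₀
  have hnhds := (isOpen_tcone α R).mem_nhds hz₀
  have hpre := (convex_tcone (β / 4) (4 * M')).isPreconnected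
  have hKd : DifferentiableOn ℂ K (tcone (β / 4) (4 * M')) := fun w hw =>
    (hK w hw).2.2.1.differentiableWithinAt
  have hFK : Set.EqOn (Ftr ν) K (tcone (β / 4) (4 * M')) :=
    (((differentiableOn_Ftr ν).mono hUHP).analyticOnNhd hopen).eqOn_of_preconnected_of_eventuallyEq
      (hKd.analyticOnNhd hopen) hpre hz₀' (Filter.mem_of_superset hnhds hdeep)
  have hψK : DifferentiableOn ℂ (fun z => z - s * ψ (K z)) (tcone (β / 4) (4 * M')) :=
    differentiableOn_id.sub ((hψ.comp hKd fun z hz => hsub (hsub' (hKmem z hz))).const_mul _)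
  have htF : Set.EqOn (Ftr tν) (fun z => z - s * ψ (K z)) (tcone (β / 4) (4 * M')) := by
    refine (((differentiableOn_Ftr tν).mono hUHP).analyticOnNhd
      hopen).eqOn_of_preconnected_of_eventuallyEq (hψK.analyticOnNhd hopen) hpre hz₀'
      (Filter.mem_of_superset hnhds fun z hz => ?_)
    have h := htν z (tcone_mono hαα₂ hR.le hRN₂ hz)
    rw [hdeep z hz] at h
    change Ftr tν z = z - s * ψ (K z)
    linear_combination h
  intro z hz
  rw [hFK hz, htF hz]
  exact ⟨hKmem z hz, (hK z hz).2.2.2, by linear_combination (hK z hz).2.1, by ring⟩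

/-- For a two-state free convolution semigroup `{(tμ t, μ t)}`
(`φ_{μ_t} = t·φ`, `φ_{tμ_t,μ_t} = t·ψ`), one has, on a suitable truncated cone in `ℂ⁺`, the
evolution equations
`∂_t F_{tμ_t}(z) = φ(F_{μ_t}(z)) − ψ(F_{μ_t}(z)) − φ(F_{μ_t}(z))·∂_z F_{tμ_t}(z)` and
`∂_t F_{μ_t}(z) = − φ(F_{μ_t}(z))·∂_z F_{μ_t}(z)`. -/
theorem stmt15
    (μ tμ : ℝ → Measure ℝ)
    (hprob : ∀ t : ℝ, 0 ≤ t → IsProbabilityMeasure (μ t) ∧ IsProbabilityMeasure (tμ t))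
    (φ ψ : ℂ → ℂ)
    (hsemi : ∀ t : ℝ, 0 ≤ t → IsVT (μ t) (fun z => (t : ℂ) * φ z))
    (h2semi : ∀ t : ℝ, 0 ≤ t → IsTwoStateVT (tμ t) (μ t) (fun z => (t : ℂ) * ψ z)) :
    ∀ t : ℝ, 0 < t → ∃ α M : ℝ, 0 < α ∧ 0 < M ∧ ∀ z ∈ tcone α M,
      HasDerivAt (fun s : ℝ => Ftr (tμ s) z)
        (φ (Ftr (μ t) z) - ψ (Ftr (μ t) z)
          - φ (Ftr (μ t) z) * deriv (fun w => Ftr (tμ t) w) z) t ∧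
      HasDerivAt (fun s : ℝ => Ftr (μ s) z)
        (- φ (Ftr (μ t) z) * deriv (fun w => Ftr (μ t) w) z) t := by
  intro t ht
  obtain ⟨_, _⟩ := hprob 1 zero_le_one
  obtain ⟨β, M, hβ, hM, hφ, hψ, hφo⟩ := exists_differentiableOn_VT (φ := φ) (ψ := ψ)
    (by simpa using hsemi 1 zero_le_one) (by simpa using h2semi 1 zero_le_one)
  obtain ⟨γ, δ, N, C, hγ, hN, hC, hsub, hφb, h⟩ :=
    exists_uniform_tcone hβ hM hφ hψ hφo (T := 2 * t) (by positivity)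
  have hlip := (h t ht (by linarith)).1
  have hF : ∀ s : ℝ, 0 < s → s < 2 * t → ∀ z ∈ tcone γ (2 * N), _ := fun s hs hst =>
    (h s hs hst).2 (μ s) (tμ s) (hprob s hs.le).1 (hprob s hs.le).2 (hsemi s hs.le)
      (h2semi s hs.le)
  have hFt := hF t ht (by linarith)
  obtain ⟨_, _⟩ := hprob t ht.le
  refine ⟨γ, 2 * N, hγ, by positivity, fun z hz => ?_⟩
  have hs : ∀ᶠ s in nhds t, 0 < s ∧ s < 2 * t :=
    (lt_mem_nhds ht).and (gt_mem_nhds (by linarith))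
  have hzn := (isOpen_tcone γ (2 * N)).mem_nhds hz
  have hzU : z ∈ UHP := tcone_subset_UHP (by positivity) hz
  have hFd : HasDerivAt (Ftr (μ t)) (deriv (Ftr (μ t)) z) z :=
    ((differentiableOn_Ftr (μ t)).differentiableAt (isOpen_UHP.mem_nhds hzU)).hasDerivAt
  have hmemn := (isOpen_tcone β M).mem_nhds (hsub (hFt z hz).1)
  have hcont : ContinuousAt (fun s => Ftr (μ s) z) t := by
    rw [ContinuousAt, tendsto_iff_norm_sub_tendsto_zero]
    have hlim : Filter.Tendsto (fun s => 2 * (|t - s| * (C * (2 * ‖z‖)))) (nhds t) (nhds 0) := by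
      have : Continuous fun s => 2 * (|t - s| * (C * (2 * ‖z‖))) := by fun_prop
      simpa using this.tendsto t
    refine squeeze_zero' (.of_forall fun _ => norm_nonneg _) ?_ hlim
    filter_upwards [hs] with s hs
    obtain ⟨hm, hn, he, -⟩ := hF s hs.1 hs.2 z hz
    obtain ⟨hm', -, he', -⟩ := hFt z hz
    have h1 : Ftr (μ s) z - Ftr (μ t) z = ((t - s : ℝ) : ℂ) * φ (Ftr (μ s) z) -
        (t * φ (Ftr (μ s) z) - t * φ (Ftr (μ t) z)) := by
      push_cast
      linear_combination he - he'
    have h2 : ‖((t - s : ℝ) : ℂ) * φ (Ftr (μ s) z)‖ ≤ |t - s| * (C * (2 * ‖z‖)) := by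
      rw [norm_mul, norm_real, Real.norm_eq_abs]
      exact mul_le_mul_of_nonneg_left ((hφb _ hm).trans (mul_le_mul_of_nonneg_left hn hC))
        (abs_nonneg _)
    have h3 := norm_sub_le (((t - s : ℝ) : ℂ) * φ (Ftr (μ s) z))
      (t * φ (Ftr (μ s) z) - t * φ (Ftr (μ t) z))
    rw [← h1] at h3
    linarith [hlip _ hm _ hm']
  have hφc : ContinuousAt (fun s => φ (Ftr (μ s) z)) t :=
    ContinuousAt.comp (f := fun s => Ftr (μ s) z) (hφ.differentiableAt hmemn).continuousAt hcont
  have hu : HasDerivAt (fun s : ℝ => z + ((t - s : ℝ) : ℂ) * φ (Ftr (μ s) z))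
      (-φ (Ftr (μ t) z)) t := by
    rw [hasDerivAt_iff_tendsto_slope]
    refine (hφc.neg.tendsto.mono_left nhdsWithin_le_nhds).congr' ?_
    filter_upwards [self_mem_nhdsWithin] with s hst
    have hst : (s : ℂ) - t ≠ 0 := sub_ne_zero.2 (ofReal_injective.ne hst)
    simp only [Pi.neg_apply, slope, vsub_eq_sub, sub_self, ofReal_zero, zero_mul, add_zero, add_sub_cancel_left,
      real_smul, ofReal_inv, ofReal_sub]
    field_simp
    ring
  have hμ : HasDerivAt (fun s : ℝ => Ftr (μ s) z)
      (-φ (Ftr (μ t) z) * deriv (fun w => Ftr (μ t) w) z) t := by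
    have hut : z + ((t - t : ℝ) : ℂ) * φ (Ftr (μ t) z) = z := by simp
    have hcomp := HasDerivAt.scomp_of_eq (g₁ := Ftr (μ t)) t hFd hu hut.symm
    refine hcomp.congr_of_eventuallyEq ?_
    have hun := hu.continuousAt.preimage_mem_nhds (t := tcone γ (2 * N)) (by rwa [hut])
    filter_upwards [hs, hun] with s hs hus
    obtain ⟨hm, -, he, -⟩ := hF s hs.1 hs.2 z hz
    obtain ⟨hm', -, he', -⟩ := hFt _ hus
    rw [Function.comp_apply]
    beta_reduce at hm' he'
    have hl := hlip _ hm _ hm'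
    generalize Ftr (μ t) (z + ((t - s : ℝ) : ℂ) * φ (Ftr (μ s) z)) = k at hm' he' hl ⊢
    rw [show (t : ℂ) * φ (Ftr (μ s) z) - t * φ k = -(Ftr (μ s) z - k) by
      push_cast at he'
      linear_combination he - he', norm_neg] at hl
    exact sub_eq_zero.1 (norm_eq_zero.1 (by linarith [norm_nonneg (Ftr (μ s) z - k)]))
  refine ⟨?_, hμ⟩
  have hψd := (hψ.differentiableAt hmemn).hasDerivAt
  have htz : HasDerivAt (fun w => Ftr (tμ t) w)
      (1 - t * (deriv ψ (Ftr (μ t) z) * deriv (Ftr (μ t)) z)) z := by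
    refine ((hasDerivAt_id' z).sub ((hψd.comp z hFd).const_mul (t : ℂ))).congr_of_eventuallyEq ?_
    filter_upwards [hzn] with w hw
    simp only [Pi.sub_apply, Function.comp_apply]
    linear_combination (hFt w hw).2.2.2
  have hts : HasDerivAt (fun s : ℝ => z - (s : ℂ) * ψ (Ftr (μ s) z)) _ t :=
    ((hasDerivAt_id' t).ofReal_comp.mul (hψd.comp t hμ)).const_sub z
  rw [htz.deriv]
  refine (hts.congr_of_eventuallyEq ?_).congr_deriv ?_
  · filter_upwards [hs] with s hs
    linear_combination (hF s hs.1 hs.2 z hz).2.2.2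
  · simp only [Function.comp_apply, ofReal_one]
    ring
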